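/- Let n be a positive integer, and let b, c be real numbers such that c ∉ {0, -1, -2, …, -n+1} and 1+b-c-n ∉ {0, -1, -2, …, -n+1}. Then for every real number x, ₂F₁(-n, b; c; 1-x) = [(c-b)_n / (c)_n] · ₂F₁(-n, b; -n+b+1-c; x), where (a)_n denotes the rising factorial a(a+1)⋯(a+n-1). -/

import Mathlib

/-- The Gaussian hypergeometric series `₂F₁(a, b; c; x)` for real parameters,
defined as `∑ (a)_k (b)_k / ((c)_k k!) x^k` where `(a)_k` is the rising factorial. -/
noncomputable def hyp2F1 (a b c x : ℝ) : ℝ :=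
  ∑' k : ℕ, (ascPochhammer ℝ k).eval a * (ascPochhammer ℝ k).eval b /
      ((ascPochhammer ℝ k).eval c * (Nat.factorial k : ℝ)) * x ^ k

open Polynomial Finset

section Pochhammer

variable {R : Type*} [CommRing R]

theorem ascPochhammer_eval_succ_left (k : ℕ) (a : R) :
    (ascPochhammer R (k + 1)).eval a = a * (ascPochhammer R k).eval (a + 1) := by
  simp [ascPochhammer_succ_left, eval_comp]

theorem ascPochhammer_eval_add (m k : ℕ) (a : R) :
    (ascPochhammer R (m + k)).eval a =
      (ascPochhammer R m).eval a * (ascPochhammer R k).eval (a + m) := by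
  simp [← ascPochhammer_mul, eval_comp]

theorem ascPochhammer_eval_one_sub_sub (k : ℕ) (a : R) :
    (ascPochhammer R k).eval (1 - a - k) = (-1) ^ k * (ascPochhammer R k).eval a := by
  rw [show 1 - a - (k : R) = -a - k + 1 by ring, ← descPochhammer_eval_eq_ascPochhammer]
  have h := ascPochhammer_eval_neg_eq_descPochhammer R (-a) k
  rw [neg_neg] at h
  rw [h, ← mul_assoc, ← mul_pow]
  simp

theorem ascPochhammer_eval_neg_natCast (n k : ℕ) :
    (ascPochhammer R k).eval (-(n : R)) = (-1) ^ k * (n.choose k * k.factorial) := by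
  rw [ascPochhammer_eval_neg_eq_descPochhammer, descPochhammer_eval_eq_descFactorial,
    Nat.descFactorial_eq_factorial_mul_choose, Nat.cast_mul, mul_comm (k.factorial : R)]

/-- The reflection formula for terminating `₂F₁`, with denominators cleared. -/
theorem sum_choose_mul_ascPochhammer_one_sub_pow (n : ℕ) (b c x : R) :
    ∑ k ∈ range (n + 1), (n.choose k : R) * ((-1) ^ k * (ascPochhammer R k).eval b *
        (ascPochhammer R (n - k)).eval (c + k) * (1 - x) ^ k) =
      ∑ k ∈ range (n + 1), (n.choose k : R) * ((ascPochhammer R k).eval b *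
        (ascPochhammer R (n - k)).eval (c - b) * x ^ k) := by
  induction n generalizing b c with
  | zero => simp
  | succ n ih =>
    rw [sum_choose_succ_mul (fun i j ↦ (-1) ^ i * (ascPochhammer R i).eval b *
        (ascPochhammer R j).eval (c + i) * (1 - x) ^ i),
      sum_choose_succ_mul (fun i j ↦ (ascPochhammer R i).eval b *
        (ascPochhammer R j).eval (c - b) * x ^ i)]
    trans b * x * (∑ k ∈ range (n + 1), (n.choose k : R) * ((-1) ^ k *
          (ascPochhammer R k).eval (b + 1) * (ascPochhammer R (n - k)).eval (c + 1 + k) *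
          (1 - x) ^ k)) +
        (c - b) * (∑ k ∈ range (n + 1), (n.choose k : R) * ((-1) ^ k *
          (ascPochhammer R k).eval b * (ascPochhammer R (n - k)).eval (c + 1 + k) * (1 - x) ^ k))
    · simp only [mul_sum, ← sum_add_distrib]
      refine sum_congr rfl fun k hk ↦ ?_
      have hkn : k ≤ n := Nat.lt_succ_iff.mp (mem_range.mp hk)
      have hb : b * (ascPochhammer R k).eval (b + 1) = (ascPochhammer R k).eval b * (b + k) := by
        rw [← ascPochhammer_eval_succ_left, ascPochhammer_succ_eval]
      rw [Nat.sub_add_comm hkn, ascPochhammer_eval_succ_left, ascPochhammer_succ_eval,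
        show c + ((k + 1 : ℕ) : R) = c + 1 + k by push_cast; ring,
        show c + (k : R) + 1 = c + 1 + k by ring]
      linear_combination -((n.choose k : R) * (-1) ^ k * x *
        (ascPochhammer R (n - k)).eval (c + 1 + k) * (1 - x) ^ k) * hb
    · rw [ih, ih, add_comm]
      simp only [mul_sum]
      congr 1 <;> refine sum_congr rfl fun k hk ↦ ?_
      · have hkn : k ≤ n := Nat.lt_succ_iff.mp (mem_range.mp hk)
        rw [Nat.sub_add_comm hkn, ascPochhammer_eval_succ_left (n - k),
          show c + 1 - b = c - b + 1 by ring]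
        ring
      · rw [ascPochhammer_eval_succ_left k, show c + 1 - (b + 1) = c - b by ring]
        ring

end Pochhammer

theorem ascPochhammer_eval_ne_zero {n : ℕ} {a : ℝ} (h : ∀ k : ℕ, k < n → a ≠ -(k : ℝ)) :
    (ascPochhammer ℝ n).eval a ≠ 0 := by
  rw [Ne, ascPochhammer_eval_eq_zero_iff]
  rintro ⟨k, hk, hka⟩
  exact h k hk (by linarith)

theorem hyp2F1_neg_natCast (n : ℕ) (b c x : ℝ) :
    hyp2F1 (-(n : ℝ)) b c x = ∑ k ∈ range (n + 1), (n.choose k : ℝ) *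
      ((-1) ^ k * (ascPochhammer ℝ k).eval b / (ascPochhammer ℝ k).eval c * x ^ k) := by
  rw [hyp2F1, tsum_eq_sum (s := range (n + 1))]
  · refine sum_congr rfl fun k _ ↦ ?_
    have hk : (k.factorial : ℝ) ≠ 0 := Nat.cast_ne_zero.mpr k.factorial_ne_zero
    rw [ascPochhammer_eval_neg_natCast, ← div_div]
    field_simp
  · intro k hk
    have hnk : n < k := not_le.mp fun h ↦ hk (mem_range.mpr (Nat.lt_succ_of_le h))
    simp only [ascPochhammer_eval_neg_coe_nat_of_lt hnk, zero_mul, zero_div]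

/-- Hannah's form of the reflection formula: for a positive integer `n`, with
`c ∉ {0, -1, …, -n+1}` and `1+b-c-n ∉ {0, -1, …, -n+1}`,
`₂F₁(-n, b; c; 1-x) = ((c-b)_n / (c)_n) ₂F₁(-n, b; -n+b+1-c; x)` for all real `x`. -/
theorem reflection_2F1_Hannah (n : ℕ) (hn : 0 < n) (b c : ℝ)
    (hc : ∀ k : ℕ, k < n → c ≠ -(k : ℝ))
    (hc' : ∀ k : ℕ, k < n → 1 + b - c - (n : ℝ) ≠ -(k : ℝ)) :
    ∀ x : ℝ,
      hyp2F1 (-(n : ℝ)) b c (1 - x) =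
        (ascPochhammer ℝ n).eval (c - b) / (ascPochhammer ℝ n).eval c *
          hyp2F1 (-(n : ℝ)) b (-(n : ℝ) + b + 1 - c) x := by
  intro x
  have hcn := ascPochhammer_eval_ne_zero hc
  rw [div_mul_eq_mul_div, eq_div_iff hcn, hyp2F1_neg_natCast, hyp2F1_neg_natCast, sum_mul,
    mul_sum]
  trans ∑ k ∈ range (n + 1), (n.choose k : ℝ) * ((-1) ^ k * (ascPochhammer ℝ k).eval b *
        (ascPochhammer ℝ (n - k)).eval (c + k) * (1 - x) ^ k)
  · refine sum_congr rfl fun k hk ↦ ?_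
    have hkn : k ≤ n := Nat.lt_succ_iff.mp (mem_range.mp hk)
    have hck := ascPochhammer_eval_ne_zero fun j hj ↦ hc j (hj.trans_le hkn)
    have hsplit := ascPochhammer_eval_add k (n - k) c
    rw [Nat.add_sub_cancel' hkn] at hsplit
    rw [hsplit]
    field_simp
  · rw [sum_choose_mul_ascPochhammer_one_sub_pow]
    refine sum_congr rfl fun k hk ↦ ?_
    have hkn : k ≤ n := Nat.lt_succ_iff.mp (mem_range.mp hk)
    have hdk := ascPochhammer_eval_ne_zero fun j hj ↦ hc' j (hj.trans_le hkn)
    have hsplit := ascPochhammer_eval_add (n - k) k (c - b)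
    rw [Nat.sub_add_cancel hkn] at hsplit
    have hrefl := ascPochhammer_eval_one_sub_sub k (c - b + ((n - k : ℕ) : ℝ))
    rw [show 1 - (c - b + ((n - k : ℕ) : ℝ)) - k = 1 + b - c - n by
      rw [Nat.cast_sub hkn]; ring] at hrefl
    rw [show -(n : ℝ) + b + 1 - c = 1 + b - c - n by ring, hsplit]
    rw [hrefl] at hdk ⊢
    have hne := right_ne_zero_of_mul hdk
    field_simp
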